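/- Let k be a field of characteristic 0, and let M be a finite-dimensional k((t))-vector space with a connection ∇ (i.e. a k-linear operator ∂_t : M → M satisfying the Leibniz rule ∂_t(fm) = f'm + f∂_t(m)). If M has no nonzero horizontal sections (ker ∂_t = 0), then ∂_t : M → M is bijective. -/

import Mathlib

/-- The formal derivative d/dt on the field of formal Laurent series `k((t))`. -/
noncomputable def lderiv {k : Type} [Field k] (f : LaurentSeries k) : LaurentSeries k where
  coeff n := (n + 1 : ℤ) • f.coeff (n + 1)
  isPWO_support' := by
    refine Set.IsPWO.mono (f.isPWO_support.image_of_monotone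
      (f := fun n : ℤ => n - 1) (fun a b h => by simpa using h)) ?_
    intro n hn
    refine ⟨n + 1, ?_, by ring⟩
    intro h
    simp only [Function.mem_support] at hn
    exact hn (by simp [h])

/-- Vanishing of all coefficients below `n`. -/
def VanBelow {k : Type} [Field k] (n : ℤ) (f : LaurentSeries k) : Prop :=
  ∀ i < n, f.coeff i = 0

/-- `P` has shift `j` and indicial function `p`. -/
def HasSymb {k : Type} [Field k] (P : LaurentSeries k →ₗ[k] LaurentSeries k)
    (j : ℤ) (p : ℤ → k) : Prop :=
  ∀ n f, VanBelow n f → VanBelow (n + j) (P f) ∧ (P f).coeff (n + j) = p n * f.coeff n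

theorem vanBelow_single {k : Type} [Field k] (n : ℤ) (a : k) :
    VanBelow n (HahnSeries.single n a : LaurentSeries k) := by
  intro i hi
  exact HahnSeries.coeff_single_of_ne hi.ne

theorem exists_vanBelow {k : Type} [Field k] (f : LaurentSeries k) : ∃ n, VanBelow n f :=
  ⟨f.order, fun _ hi => HahnSeries.coeff_eq_zero_of_lt_order hi⟩

/-- partial solutions -/
noncomputable def partialSol {k : Type} [Field k] (P : LaurentSeries k →ₗ[k] LaurentSeries k)
    (j : ℤ) (p : ℤ → k) (N : ℤ) (g : LaurentSeries k) : ℕ → LaurentSeries k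
  | 0 => 0
  | i + 1 => partialSol P j p N g i + HahnSeries.single (N + i)
      ((g - P (partialSol P j p N g i)).coeff (N + i + j) / p (N + i))

theorem solve_high {k : Type} [Field k] (P : LaurentSeries k →ₗ[k] LaurentSeries k)
    (j : ℤ) (p : ℤ → k) (hP : HasSymb P j p) (N : ℤ) (hN : ∀ n, N ≤ n → p n ≠ 0)
    (g : LaurentSeries k) (hg : VanBelow (N + j) g) :
    ∃ f, VanBelow N f ∧ P f = g := by
  set S := partialSol P j p N g with hS
  have hSs : ∀ i, S (i + 1) = S i + HahnSeries.single (N + i)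
      ((g - P (S i)).coeff (N + i + j) / p (N + i)) := fun i => rfl
  have hS0 : S 0 = 0 := rfl
  let c : ℤ → k := fun n => if n < N then 0 else (S ((n - N).toNat + 1)).coeff n
  have hc : ∀ n < N, c n = 0 := fun n hn => by simp [c, hn]
  let f : LaurentSeries k := HahnSeries.ofSuppBddBelow c
    (HahnSeries.forallLTEqZero_supp_BddBelow c N hc)
  have hf : ∀ n, f.coeff n = c n := fun n => rfl
  have h1 : ∀ i : ℕ, ∀ n < N + i, f.coeff n = (S i).coeff n := by
    intro i
    induction i with
    | zero => intro n hn; rw [hf, hc n (by simpa using hn), hS0]; simp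
    | succ i ih =>
      intro n hn
      by_cases h : n < N + i
      · rw [hSs, HahnSeries.coeff_add, vanBelow_single _ _ n h, add_zero, ih n h]
      · have : n = N + i := by push_cast at hn; omega
        subst this
        simp [hf, c]
  have h2 : ∀ i : ℕ, VanBelow (N + i + j) (P (S i) - g) := by
    intro i
    induction i with
    | zero => intro n hn; rw [hS0]; simp [hg n (by simpa using hn)]
    | succ i ih =>
      intro n hn
      obtain ⟨ha, hb⟩ := hP _ _ (vanBelow_single (N + i)
        ((g - P (S i)).coeff (N + i + j) / p (N + i)))
      rw [hSs, map_add]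
      by_cases h : n < N + i + j
      · have := ih n h
        have := ha n h
        simp_all
      · have : n = N + i + j := by push_cast at hn; omega
        subst this
        have hp := hN (N + i) (by omega)
        rw [HahnSeries.coeff_sub, HahnSeries.coeff_add, hb, HahnSeries.coeff_single_same,
          mul_div_cancel₀ _ hp]
        simp
  refine ⟨f, hc, ?_⟩
  ext n
  let i := (n - N - j).toNat + 1
  have hn : n < N + i + j := by simp only [i]; push_cast; omega
  have h3 : VanBelow (N + i) (f - S i) := by
    intro l hl
    simp [h1 i l hl]
  have h4 := (hP _ _ h3).1 n hn
  have h5 := h2 i n hn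
  rw [map_sub, HahnSeries.coeff_sub, sub_eq_zero] at h4
  rw [HahnSeries.coeff_sub, sub_eq_zero] at h5
  rw [h4, h5]

theorem surj_of_inj {k : Type} [Field k] (P : LaurentSeries k →ₗ[k] LaurentSeries k)
    (j : ℤ) (p : ℤ → k) (hP : HasSymb P j p) (N₀ : ℤ) (hN₀ : ∀ n, N₀ ≤ n → p n ≠ 0)
    (hinj : ∀ f, P f = 0 → f = 0) (g : LaurentSeries k) : ∃ f, P f = g := by
  obtain ⟨n₀, hg⟩ := exists_vanBelow g
  obtain ⟨n, rfl⟩ : ∃ n, n₀ = n + j := ⟨n₀ - j, by ring⟩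
  obtain ⟨d, hd⟩ : ∃ d : ℕ, N₀ ≤ n + d := ⟨(N₀ - n).toNat, by omega⟩
  have hN : ∀ l, n + d ≤ l → p l ≠ 0 := fun l hl => hN₀ l (hd.trans hl)
  let s : (Fin d → k) →ₗ[k] LaurentSeries k :=
    { toFun := fun v => ∑ i : Fin d, HahnSeries.single (n + (i : ℕ) : ℤ) (v i)
      map_add' := fun v w => by simp [Finset.sum_add_distrib]
      map_smul' := fun a v => by
        simp only [Pi.smul_apply, RingHom.id_apply, Finset.smul_sum]
        refine Finset.sum_congr rfl fun i _ => ?_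
        ext l; simp [HahnSeries.coeff_single] }
  have hs : ∀ v l, (s v).coeff l = ∑ i : Fin d, if l = n + (i : ℕ) then v i else 0 := by
    intro v l
    simp only [s, LinearMap.coe_mk, AddHom.coe_mk, HahnSeries.coeff_sum, HahnSeries.coeff_single]
    exact Finset.sum_congr rfl fun i _ => by split_ifs <;> rfl
  have hsvan : ∀ v, VanBelow n (s v) := by
    intro v l hl
    rw [hs]
    refine Finset.sum_eq_zero fun i _ => if_neg (by omega)
  have hsc : ∀ v (i : Fin d), (s v).coeff (n + (i : ℕ)) = v i := by
    intro v i
    rw [hs, Finset.sum_eq_single i]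
    · simp
    · intro b _ hb
      refine if_neg fun h => hb (Fin.ext (by omega))
    · simp
  let T : (Fin d → k) →ₗ[k] (Fin d → k) :=
    { toFun := fun v i => (P (s v)).coeff (n + j + (i : ℕ))
      map_add' := fun v w => by ext; simp
      map_smul' := fun a v => by ext; simp }
  have key : ∀ (h : LaurentSeries k), VanBelow (n + j) h →
      (∀ i : Fin d, h.coeff (n + j + (i : ℕ)) = 0) → VanBelow (n + d + j) h := by
    intro h h1 h2 l hl
    by_cases hl' : l < n + j
    · exact h1 l hl'
    · have := h2 ⟨(l - (n + j)).toNat, by omega⟩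
      rw [← this]
      congr 1
      simp; omega
  have hT : Function.Injective T := by
    rw [← LinearMap.ker_eq_bot, LinearMap.ker_eq_bot']
    intro v hv
    have h1 := key _ (hP _ _ (hsvan v)).1 (fun i => congrFun hv i)
    obtain ⟨f, hf, hf'⟩ := solve_high P j p hP (n + d) hN _ h1
    have h2 : f = s v := by
      rw [← sub_eq_zero]; apply hinj; rw [map_sub, hf', sub_self]
    ext i
    rw [← hsc v i, ← h2]
    exact hf _ (by omega)
  obtain ⟨v, hv⟩ := (LinearMap.injective_iff_surjective.mp hT) (fun i => g.coeff (n + j + (i : ℕ)))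
  have h1 : VanBelow (n + d + j) (g - P (s v)) := by
    apply key
    · intro l hl
      simp [hg l hl, (hP _ _ (hsvan v)).1 l hl]
    · intro i
      have : (P (s v)).coeff (n + j + (i : ℕ)) = g.coeff (n + j + (i : ℕ)) := congrFun hv i
      simp [this]
  obtain ⟨f, -, hf⟩ := solve_high P j p hP (n + d) hN _ h1
  exact ⟨f + s v, by rw [map_add, hf]; simp⟩

/-- `lderiv` as a linear map. -/
noncomputable def lderivL (k : Type) [Field k] : LaurentSeries k →ₗ[k] LaurentSeries k where
  toFun := lderiv
  map_add' f g := by ext n; simp [lderiv, mul_add]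
  map_smul' a f := by ext n; simp [lderiv, mul_left_comm]

theorem lderivL_pow_coeff {k : Type} [Field k] (i : ℕ) (f : LaurentSeries k) (l : ℤ) :
    ((lderivL k ^ i) f).coeff l = (ascPochhammer k i).eval ((l : k) + 1) * f.coeff (l + i) := by
  induction i generalizing f with
  | zero => simp
  | succ i ih =>
    rw [pow_succ, Module.End.mul_apply, ih, ascPochhammer_succ_eval]
    simp only [lderivL, LinearMap.coe_mk, AddHom.coe_mk, lderiv, zsmul_eq_mul]
    push_cast
    rw [mul_assoc, add_assoc l]
    congr 2
    ring

theorem mul_lead {k : Type} [Field k] (a n : ℤ) (b f : LaurentSeries k) (hb : VanBelow a b)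
    (hf : VanBelow n f) :
    VanBelow (a + n) (b * f) ∧ (b * f).coeff (a + n) = b.coeff a * f.coeff n := by
  constructor
  · intro l hl
    rw [HahnSeries.coeff_mul]
    refine Finset.sum_eq_zero fun x hx => ?_
    rw [Finset.mem_antidiagonal] at hx
    by_cases h : x.1 < a
    · rw [hb _ h, zero_mul]
    · rw [hf _ (by omega), mul_zero]
  · rw [HahnSeries.coeff_mul, Finset.sum_eq_single (a, n)]
    · rintro ⟨x, y⟩ hx hne
      rw [Finset.mem_antidiagonal] at hx
      simp only at hx ⊢
      by_cases h : x < a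
      · rw [hb _ h, zero_mul]
      · by_cases h' : y < n
        · rw [hf _ h', mul_zero]
        · exact absurd (Prod.ext (by simp; omega) (by simp; omega)) hne
    · intro h
      rw [Finset.mem_antidiagonal] at h
      simp only [HahnSeries.mem_support, and_true] at h
      by_contra h'
      exact h ⟨left_ne_zero_of_mul h', right_ne_zero_of_mul h'⟩

/-- Multiplication as a linear map. -/
noncomputable def mulL {k : Type} [Field k] (b : LaurentSeries k) :
    LaurentSeries k →ₗ[k] LaurentSeries k where
  toFun f := b * f
  map_add' f g := mul_add _ _ _
  map_smul' a f := by
    simp only [RingHom.id_apply]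
    rw [← HahnSeries.C_mul_eq_smul, ← HahnSeries.C_mul_eq_smul, mul_left_comm]

/-- The adjoint operator. -/
noncomputable def adjOp {k : Type} [Field k] (r : ℕ) (b : ℕ → LaurentSeries k) :
    LaurentSeries k →ₗ[k] LaurentSeries k :=
  ∑ i ∈ Finset.range (r + 1), (-1 : k) ^ i • ((lderivL k ^ i) ∘ₗ mulL (b i))

theorem adjOp_apply {k : Type} [Field k] (r : ℕ) (b : ℕ → LaurentSeries k) (f) :
    adjOp r b f = ∑ i ∈ Finset.range (r + 1), (-1 : k) ^ i • (lderivL k ^ i) (b i * f) := by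
  simp [adjOp, LinearMap.sum_apply, mulL]

open Polynomial in
theorem adjOp_symb {k : Type} [Field k] [CharZero k] (r : ℕ) (b : ℕ → LaurentSeries k)
    (hb : b r = 1) :
    ∃ j p, HasSymb (adjOp r b) j p ∧ ∃ N₀ : ℤ, ∀ n, N₀ ≤ n → p n ≠ 0 := by
  classical
  obtain ⟨i₀, hi₀, hmin⟩ := Finset.exists_min_image
    ((Finset.range (r + 1)).filter (fun i => b i ≠ 0)) (fun i => (b i).order - (i : ℤ))
    ⟨r, by simp [hb]⟩
  simp only [Finset.mem_filter, Finset.mem_range] at hi₀ hmin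
  set j : ℤ := (b i₀).order - i₀ with hj
  have hvan : ∀ i ∈ Finset.range (r + 1), VanBelow (j + i) (b i) := by
    intro i hi l hl
    by_cases h : b i = 0
    · simp [h]
    · have := hmin i ⟨Finset.mem_range.mp hi, h⟩
      exact HahnSeries.coeff_eq_zero_of_lt_order (by omega)
  let q : k[X] := ∑ i ∈ Finset.range (r + 1),
    C ((-1 : k) ^ i * (b i).coeff (j + i)) * (ascPochhammer k i).comp (X + C ((j : k) + 1))
  have hq : ∀ x, q.eval x = ∑ i ∈ Finset.range (r + 1),
      ((-1 : k) ^ i * (b i).coeff (j + i)) * (ascPochhammer k i).eval (x + ((j : k) + 1)) := by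
    intro x; simp [q, eval_finsetSum]
  have hq0 : q ≠ 0 := by
    have hex : ∃ s, s < r + 1 ∧ (b s).coeff (j + s) ≠ 0 := by
      refine ⟨i₀, hi₀.1, ?_⟩
      rw [hj, sub_add_cancel]
      exact fun h => hi₀.2 (HahnSeries.coeff_order_eq_zero.mp h)
    obtain ⟨hs1, hs2⟩ := Nat.find_spec hex
    set s := Nat.find hex
    intro h0
    have h1 := hq (-(s : k) - ((j : k) + 1))
    rw [h0, eval_zero, Finset.sum_eq_single s] at h1
    · rw [sub_add_cancel] at h1
      have h2 : (ascPochhammer k s).eval (-(s : k)) ≠ 0 := by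
        rw [Ne, ascPochhammer_eval_eq_zero_iff]
        rintro ⟨l, hl, hl'⟩
        rw [neg_neg] at hl'
        exact hl.ne (by exact_mod_cast hl')
      exact mul_ne_zero (mul_ne_zero (pow_ne_zero _ (by simp)) hs2) h2 h1.symm
    · intro i hi hne
      rcases lt_or_gt_of_ne hne with h | h
      · have := Nat.find_min hex h
        simp only [not_and, not_not] at this
        rw [this (Finset.mem_range.mp hi)]; simp
      · rw [sub_add_cancel, ascPochhammer_eval_neg_coe_nat_of_lt h, mul_zero]
    · intro h; exact absurd (Finset.mem_range.mpr hs1) h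
  refine ⟨j, fun n => q.eval (n : k), ?_, ?_⟩
  · intro n f hf
    rw [adjOp_apply]
    have hcoe : ∀ l, (∑ i ∈ Finset.range (r + 1),
        (-1 : k) ^ i • (lderivL k ^ i) (b i * f)).coeff l = ∑ i ∈ Finset.range (r + 1),
        (-1 : k) ^ i * ((ascPochhammer k i).eval ((l : k) + 1) * (b i * f).coeff (l + i)) := by
      intro l
      simp [HahnSeries.coeff_sum, lderivL_pow_coeff]
    constructor
    · intro l hl
      rw [hcoe]
      refine Finset.sum_eq_zero fun i hi => ?_
      rw [(mul_lead _ _ _ _ (hvan i hi) hf).1 _ (by omega)]; simp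
    · beta_reduce
      rw [hcoe, hq, Finset.sum_mul]
      refine Finset.sum_congr rfl fun i hi => ?_
      rw [show n + j + (i : ℤ) = j + i + n by ring, (mul_lead _ _ _ _ (hvan i hi) hf).2]
      push_cast
      rw [add_assoc (n : k)]
      ring
  · have hfin : {n : ℤ | q.eval (n : k) = 0}.Finite := by
      have : (q.rootSet k).Finite := q.rootSet_finite k
      refine Set.Finite.subset (this.preimage (f := fun n : ℤ => (n : k))
        (Int.cast_injective.injOn)) ?_
      intro n hn
      simp only [Set.mem_preimage, mem_rootSet]
      exact ⟨hq0, by simpa using hn⟩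
    obtain ⟨B, hB⟩ := hfin.bddAbove
    refine ⟨B + 1, fun n hn h => ?_⟩
    have := hB h
    omega

/-- Primitive terms in the integration by parts. -/
noncomputable def ibp {k : Type} [Field k] {M : Type} [AddCommGroup M]
    [Module (LaurentSeries k) M] (del : M → M) (m : M) : ℕ → LaurentSeries k → M
  | 0, _ => 0
  | i + 1, f => f • del^[i] m - ibp del m i (lderiv f)

/-- a formal meromorphic connection over `k((t))` with no nonzero
horizontal sections has bijective `∂_t`. -/
theorem stmt4 (k : Type) [Field k] [CharZero k]
    (M : Type) [AddCommGroup M] [Module (LaurentSeries k) M]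
    [FiniteDimensional (LaurentSeries k) M]
    (del : M → M)
    (hadd : ∀ x y : M, del (x + y) = del x + del y)
    (hleib : ∀ (f : LaurentSeries k) (m : M), del (f • m) = lderiv f • m + f • del m)
    (hnohoriz : ∀ m : M, del m = 0 → m = 0) :
    Function.Bijective del := by
  let dl : M →+ M := AddMonoidHom.mk' del hadd
  have hdl : ∀ x, dl x = del x := fun _ => rfl
  have dsub : ∀ x y, del (x - y) = del x - del y := fun x y => map_sub dl x y
  have dzero : del 0 = 0 := map_zero dl
  have dneg : ∀ x, del (-x) = -del x := fun x => map_neg dl x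
  have dsum : ∀ (s : Finset ℕ) (F : ℕ → M), del (∑ i ∈ s, F i) = ∑ i ∈ s, del (F i) :=
    fun s F => map_sum dl F s
  refine ⟨fun x y h => sub_eq_zero.mp (hnohoriz _ (by rw [dsub, h, sub_self])), fun m => ?_⟩
  let W : ℕ → Submodule (LaurentSeries k) M := fun r =>
    Submodule.span _ ((fun i => del^[i] m) '' (Finset.range r : Set ℕ))
  have hWmono : Monotone W := by
    intro a c hac
    apply Submodule.span_mono
    apply Set.image_mono
    exact_mod_cast Finset.range_mono hac
  have hmemW : ∀ i r, i < r → del^[i] m ∈ W r := fun i r h =>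
    Submodule.subset_span ⟨i, by simpa using h, rfl⟩
  have hex : ∃ r, del^[r] m ∈ W r := by
    obtain ⟨n, hn⟩ := monotone_stabilizes_iff_noetherian.mpr
      (inferInstance : IsNoetherian (LaurentSeries k) M) ⟨W, hWmono⟩
    have h : W n = W (n + 1) := hn (n + 1) (by omega)
    exact ⟨n, h ▸ hmemW n (n + 1) (by omega)⟩
  obtain ⟨r, hr, hrmin⟩ : ∃ r, del^[r] m ∈ W r ∧ ∀ s < r, del^[s] m ∉ W s := by
    classical
    exact ⟨Nat.find hex, Nat.find_spec hex, fun s hs => Nat.find_min hex hs⟩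
  obtain ⟨c, hc⟩ := Submodule.mem_span_image_finset_iff_exists_fun' _ |>.mp hr
  let b : ℕ → LaurentSeries k := fun i => if i = r then 1 else - c i
  have hbr : b r = 1 := by simp [b]
  have hrel : ∑ i ∈ Finset.range (r + 1), b i • del^[i] m = 0 := by
    rw [Finset.sum_range_succ, hbr, one_smul, ← hc, ← Finset.sum_add_distrib]
    refine Finset.sum_eq_zero fun i hi => ?_
    have : i ≠ r := (Finset.mem_range.mp hi).ne
    simp [b, this]
  -- integration by parts
  have hibp : ∀ i f, f • del^[i] m = ((-1 : k) ^ i • (lderivL k ^ i) f) • m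
      + del (ibp del m i f) := by
    intro i
    induction i with
    | zero => intro f; simp [ibp, dzero]
    | succ i ih =>
      intro f
      have h1 := ih (lderiv f)
      have h2 : (lderivL k ^ (i + 1)) f = (lderivL k ^ i) (lderiv f) := by
        rw [pow_succ]; rfl
      rw [h2, ibp, dsub, hleib, Function.iterate_succ_apply', h1, pow_succ, mul_neg_one, neg_smul,
        neg_smul]
      abel
  have hibpW : ∀ i (f : LaurentSeries k), ibp del m i f ∈ W i := by
    intro i
    induction i with
    | zero => intro f; exact Submodule.zero_mem _
    | succ i ih =>
      intro f
      exact Submodule.sub_mem _ (Submodule.smul_mem _ _ (hmemW _ _ (by omega)))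
        (hWmono (Nat.le_succ i) (ih _))
  have hadj : ∀ f, adjOp r b f • m
      + del (∑ i ∈ Finset.range (r + 1), ibp del m i (b i * f)) = 0 := by
    intro f
    rw [adjOp_apply, dsum, Finset.sum_smul, ← Finset.sum_add_distrib,
      ← smul_zero f, ← hrel, Finset.smul_sum]
    refine Finset.sum_congr rfl fun i _ => ?_
    rw [← hibp, smul_smul, mul_comm]
  rcases Nat.eq_zero_or_pos r with h0 | hpos
  · subst h0
    have : m = 0 := by simpa [W] using hr
    exact ⟨0, by rw [this, dzero]⟩
  obtain ⟨s, rfl⟩ : ∃ s, r = s + 1 := ⟨r - 1, by omega⟩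
  have hinj : ∀ f, adjOp (s + 1) b f = 0 → f = 0 := by
    intro f hf
    have h1 := hadj f
    rw [hf, zero_smul, zero_add] at h1
    have h2 := hnohoriz _ h1
    rw [Finset.sum_range_succ, hbr, one_mul, ibp] at h2
    by_contra hne
    apply hrmin s (by omega)
    have h3 : f • del^[s] m ∈ W s := by
      have : f • del^[s] m = ibp del m s (lderiv f)
          - ∑ i ∈ Finset.range (s + 1), ibp del m i (b i * f) := by
        rw [eq_sub_iff_add_eq, ← sub_eq_zero, ← h2]; abel
      rw [this]
      refine Submodule.sub_mem _ (hibpW _ _) (Submodule.sum_mem _ fun i hi => ?_)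
      exact hWmono (by simpa [Nat.lt_succ_iff] using hi) (hibpW _ _)
    exact (Submodule.smul_mem_iff _ hne).mp h3
  obtain ⟨j, p, hsymb, N₀, hN₀⟩ := adjOp_symb (s + 1) b hbr
  obtain ⟨f, hf⟩ := surj_of_inj _ j p hsymb N₀ hN₀ hinj 1
  have h1 := hadj f
  rw [hf, one_smul] at h1
  exact ⟨_, (dneg _).trans (eq_neg_of_add_eq_zero_left h1).symm⟩
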